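/- Let (S, 𝓕, ν) be a measure space with finite measure ν and let k : S × S → ℂ be measurable with ∫_S ∫_S |k(t,s)|² dν(s) dν(t) < ∞. Then the integral operator T_k : L²(S, ν) → L²(S, ν), (T_k g)(t) = ∫_S k(t,s) g(s) dν(s), is a compact operator. -/

import Mathlib

open MeasureTheory ENNReal

namespace HilbertSchmidtKernel

variable {α β : Type*} [MeasurableSpace α] [MeasurableSpace β] {μ : Measure α} {ν : Measure β}

lemma eLpNorm_two_sq {γ : Type*} [MeasurableSpace γ] (ρ : Measure γ) (f : γ → ℂ) :
    eLpNorm f 2 ρ ^ 2 = ∫⁻ x, ‖f x‖ₑ ^ 2 ∂ρ := by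
  have := eLpNorm_nnreal_pow_eq_lintegral (μ := ρ) (f := f) (p := 2) (by norm_num)
  simpa using this

lemma memLp_two_iff_lintegral {γ : Type*} [MeasurableSpace γ] {ρ : Measure γ} {f : γ → ℂ}
    (hf : AEStronglyMeasurable f ρ) : MemLp f 2 ρ ↔ ∫⁻ x, ‖f x‖ₑ ^ 2 ∂ρ < ∞ := by
  rw [← eLpNorm_two_sq, MemLp, and_iff_right hf]
  simp [ENNReal.pow_lt_top_iff]

lemma lintegral_eLpNorm_section_sq [SFinite ν] {k : α × β → ℂ}
    (hk : AEStronglyMeasurable k (μ.prod ν)) :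
    ∫⁻ t, eLpNorm (fun s => k (t, s)) 2 ν ^ 2 ∂μ = eLpNorm k 2 (μ.prod ν) ^ 2 := by
  simp_rw [eLpNorm_two_sq]
  exact (lintegral_prod _ (hk.enorm.pow_const 2)).symm

lemma ae_memLp_section [SFinite ν] {k : α × β → ℂ} (hk : MemLp k 2 (μ.prod ν)) :
    ∀ᵐ t ∂μ, MemLp (fun s => k (t, s)) 2 ν := by
  have hfin : ∫⁻ t, ∫⁻ s, ‖k (t, s)‖ₑ ^ 2 ∂ν ∂μ ≠ ∞ := by
    rw [← lintegral_prod (fun z => ‖k z‖ₑ ^ 2) (hk.1.enorm.pow_const 2)]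
    exact ((memLp_two_iff_lintegral hk.1).1 hk).ne
  filter_upwards [ae_lt_top' (hk.1.enorm.pow_const 2).lintegral_prod_right' hfin,
    hk.1.prodMk_left] with t ht hm
  exact (memLp_two_iff_lintegral hm).2 ht

lemma ae_integrable_kernel_mul [SFinite ν] {k : α × β → ℂ} {g : β → ℂ}
    (hk : MemLp k 2 (μ.prod ν)) (hg : MemLp g 2 ν) :
    ∀ᵐ t ∂μ, Integrable (fun s => k (t, s) * g s) ν := by
  filter_upwards [ae_memLp_section hk] with t ht
  exact ht.integrable_mul hg

lemma enorm_integral_mul_le {f g : β → ℂ} (hf : AEStronglyMeasurable f ν)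
    (hg : AEStronglyMeasurable g ν) :
    ‖∫ s, f s * g s ∂ν‖ₑ ≤ eLpNorm f 2 ν * eLpNorm g 2 ν :=
  calc ‖∫ s, f s * g s ∂ν‖ₑ ≤ ∫⁻ s, ‖f s * g s‖ₑ ∂ν := enorm_integral_le_lintegral_enorm _
    _ = eLpNorm (f • g) 1 ν := by simp [eLpNorm_one_eq_lintegral_enorm]
    _ ≤ eLpNorm f 2 ν * eLpNorm g 2 ν := eLpNorm_smul_le_mul_eLpNorm hg hf

lemma aestronglyMeasurable_integral_kernel [SFinite ν] {k : α × β → ℂ} {g : β → ℂ}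
    (hk : AEStronglyMeasurable k (μ.prod ν)) (hg : AEStronglyMeasurable g ν) :
    AEStronglyMeasurable (fun t => ∫ s, k (t, s) * g s ∂ν) μ :=
  (hk.mul hg.comp_snd).integral_prod_right'

lemma eLpNorm_integral_kernel_le [SFinite ν] {k : α × β → ℂ} {g : β → ℂ}
    (hk : AEStronglyMeasurable k (μ.prod ν)) (hg : AEStronglyMeasurable g ν) :
    eLpNorm (fun t => ∫ s, k (t, s) * g s ∂ν) 2 μ
      ≤ eLpNorm k 2 (μ.prod ν) * eLpNorm g 2 ν := by
  rw [← ENNReal.pow_le_pow_left_iff two_ne_zero, mul_pow, ← lintegral_eLpNorm_section_sq hk,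
    eLpNorm_two_sq μ]
  have hmeas : AEMeasurable (fun t => eLpNorm (fun s => k (t, s)) 2 ν ^ 2) μ := by
    simp_rw [eLpNorm_two_sq]
    exact (hk.enorm.pow_const 2).lintegral_prod_right'
  rw [← lintegral_mul_const'' _ hmeas]
  refine lintegral_mono_ae ?_
  filter_upwards [hk.prodMk_left] with t ht
  rw [← mul_pow]
  gcongr
  exact enorm_integral_mul_le ht hg

lemma memLp_integral_kernel [SFinite ν] {k : α × β → ℂ} {g : β → ℂ}
    (hk : MemLp k 2 (μ.prod ν)) (hg : MemLp g 2 ν) :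
    MemLp (fun t => ∫ s, k (t, s) * g s ∂ν) 2 μ :=
  ⟨aestronglyMeasurable_integral_kernel hk.1 hg.1,
    (eLpNorm_integral_kernel_le hk.1 hg.1).trans_lt (ENNReal.mul_lt_top hk.2 hg.2)⟩

variable (μ ν) in
/-- The operator `g ↦ ∫ s, k (·, s) * g s ∂ν` from `L²(ν)` to `L²(μ)`, depending linearly and
continuously on the kernel `k ∈ L²(μ × ν)`. -/
noncomputable def integralOperator [SFinite ν] :
    Lp ℂ 2 (μ.prod ν) →L[ℂ] Lp ℂ 2 ν →L[ℂ] Lp ℂ 2 μ :=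
  LinearMap.mkContinuous₂
    (LinearMap.mk₂ ℂ
      (fun k g => (memLp_integral_kernel (Lp.memLp k) (Lp.memLp g)).toLp
        (fun t => ∫ s, k (t, s) * g s ∂ν))
      (fun k₁ k₂ g => by
        rw [← MemLp.toLp_add, MemLp.toLp_eq_toLp_iff]
        filter_upwards [Measure.ae_ae_of_ae_prod (Lp.coeFn_add k₁ k₂),
          ae_integrable_kernel_mul (Lp.memLp k₁) (Lp.memLp g),
          ae_integrable_kernel_mul (Lp.memLp k₂) (Lp.memLp g)] with t ht h₁ h₂
        rw [Pi.add_apply, ← integral_add h₁ h₂]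
        refine integral_congr_ae ?_
        filter_upwards [ht] with s hs
        rw [hs, Pi.add_apply, add_mul])
      (fun c k g => by
        rw [← MemLp.toLp_const_smul, MemLp.toLp_eq_toLp_iff]
        filter_upwards [Measure.ae_ae_of_ae_prod (Lp.coeFn_smul c k)] with t ht
        rw [Pi.smul_apply, ← integral_smul]
        refine integral_congr_ae ?_
        filter_upwards [ht] with s hs
        rw [hs, Pi.smul_apply, smul_mul_assoc])
      (fun k g₁ g₂ => by
        rw [← MemLp.toLp_add, MemLp.toLp_eq_toLp_iff]
        filter_upwards [ae_integrable_kernel_mul (Lp.memLp k) (Lp.memLp g₁),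
          ae_integrable_kernel_mul (Lp.memLp k) (Lp.memLp g₂)] with t h₁ h₂
        rw [Pi.add_apply, ← integral_add h₁ h₂]
        refine integral_congr_ae ?_
        filter_upwards [Lp.coeFn_add g₁ g₂] with s hs
        rw [hs, Pi.add_apply, mul_add])
      (fun c k g => by
        rw [← MemLp.toLp_const_smul, MemLp.toLp_eq_toLp_iff]
        refine Filter.Eventually.of_forall fun t => ?_
        rw [Pi.smul_apply, ← integral_smul]
        refine integral_congr_ae ?_
        filter_upwards [Lp.coeFn_smul c g] with s hs
        rw [hs, Pi.smul_apply, mul_smul_comm]))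
    1
    (fun k g => by
      rw [LinearMap.mk₂_apply, Lp.norm_toLp, one_mul, Lp.norm_def, Lp.norm_def,
        ← ENNReal.toReal_mul]
      exact ENNReal.toReal_mono (ENNReal.mul_ne_top (Lp.eLpNorm_ne_top k) (Lp.eLpNorm_ne_top g))
        (eLpNorm_integral_kernel_le (Lp.aestronglyMeasurable k) (Lp.aestronglyMeasurable g)))

lemma integralOperator_apply_ae [SFinite ν] (k : Lp ℂ 2 (μ.prod ν)) (g : Lp ℂ 2 ν) :
    integralOperator μ ν k g =ᵐ[μ] fun t => ∫ s, k (t, s) * g s ∂ν :=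
  MemLp.coeFn_toLp (memLp_integral_kernel (Lp.memLp k) (Lp.memLp g))

lemma integralOperator_toLp_apply_ae [SFinite ν] {k : α × β → ℂ} (hk : MemLp k 2 (μ.prod ν))
    (g : Lp ℂ 2 ν) :
    integralOperator μ ν (hk.toLp k) g =ᵐ[μ] fun t => ∫ s, k (t, s) * g s ∂ν := by
  filter_upwards [integralOperator_apply_ae (hk.toLp k) g,
    Measure.ae_ae_of_ae_prod hk.coeFn_toLp] with t ht hkt
  rw [ht]
  refine integral_congr_ae ?_
  filter_upwards [hkt] with s hs
  rw [hs]

/-- The integral operator whose kernel is the indicator of a rectangle has rank at most one. -/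
lemma isCompactOperator_integralOperator_indicator_prod [IsFiniteMeasure μ] [IsFiniteMeasure ν]
    {A : Set α} {B : Set β} (hA : MeasurableSet A) (hB : MeasurableSet B) :
    IsCompactOperator (integralOperator μ ν
      (indicatorConstLp 2 (hA.prod hB) (measure_ne_top _ _) (1 : ℂ))) := by
  let φ : Lp ℂ 2 ν →L[ℂ] ℂ := innerSL ℂ (indicatorConstLp 2 hB (measure_ne_top _ _) (1 : ℂ))
  let ψ : ℂ →L[ℂ] Lp ℂ 2 μ := ContinuousLinearMap.toSpanSingleton ℂ
    (indicatorConstLp 2 hA (measure_ne_top _ _) (1 : ℂ))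
  have hψ : IsCompactOperator ψ := isCompactOperator_of_locallyCompactSpace_rng ψ
  have heq : integralOperator μ ν
      (indicatorConstLp 2 (hA.prod hB) (measure_ne_top _ _) (1 : ℂ)) = ψ.comp φ := by
    ext1 g
    refine Lp.ext ?_
    have hψφ : ψ.comp φ g = (∫ s in B, g s ∂ν) •
        indicatorConstLp 2 hA (measure_ne_top μ A) (1 : ℂ) := by
      simp [φ, ψ, L2.inner_indicatorConstLp_one]
    rw [hψφ]
    filter_upwards [integralOperator_toLp_apply_ae (memLp_indicator_const (μ := μ.prod ν) 2
      (hA.prod hB) (1 : ℂ) (Or.inr (measure_ne_top _ _))) g,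
      Lp.coeFn_smul (∫ s in B, g s ∂ν) (indicatorConstLp 2 hA (measure_ne_top μ A) (1 : ℂ)),
      indicatorConstLp_coeFn (p := 2) (hs := hA) (hμs := measure_ne_top μ A) (c := (1 : ℂ))]
      with t h₁ h₂ h₃
    rw [h₂, Pi.smul_apply, h₃]
    refine h₁.trans ?_
    rw [← integral_indicator hB]
    by_cases ht : t ∈ A
    · simp only [Set.indicator_of_mem ht, smul_eq_mul, mul_one]
      congr 1 with s
      by_cases hs : s ∈ B <;> simp [ht, hs]
    · simp [ht]
  rw [heq]
  exact hψ.comp_clm φ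

/-- An integrable function whose integral over every measurable rectangle vanishes has vanishing
integral over every measurable set. -/
lemma setIntegral_eq_zero_of_forall_prod {f : α × β → ℂ} {ρ : Measure (α × β)}
    (hf : Integrable f ρ)
    (h : ∀ (A : Set α) (B : Set β), MeasurableSet A → MeasurableSet B →
      ∫ z in A ×ˢ B, f z ∂ρ = 0)
    {E : Set (α × β)} (hE : MeasurableSet E) : ∫ z in E, f z ∂ρ = 0 := by
  induction E, hE using MeasurableSpace.induction_on_inter generateFrom_prod.symm
    isPiSystem_prod with
  | empty => simp
  | basic t ht =>
    obtain ⟨A, hA, B, hB, rfl⟩ := ht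
    exact h A B hA hB
  | compl t ht ih =>
    have huniv := h Set.univ Set.univ MeasurableSet.univ MeasurableSet.univ
    rw [Set.univ_prod_univ, setIntegral_univ] at huniv
    rw [setIntegral_compl ht hf, ih, huniv, sub_zero]
  | iUnion t hd hm ih =>
    rw [integral_iUnion hm hd hf.integrableOn]
    simp [ih]

/-- Indicators of measurable rectangles span a dense subspace of `L²(μ × ν)`. -/
lemma eq_top_of_forall_indicator_prod_mem [IsFiniteMeasure μ] [IsFiniteMeasure ν]
    {M : Submodule ℂ (Lp ℂ 2 (μ.prod ν))} (hM : IsClosed (M : Set (Lp ℂ 2 (μ.prod ν))))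
    (h : ∀ (A : Set α) (B : Set β) (hA : MeasurableSet A) (hB : MeasurableSet B),
      indicatorConstLp 2 (hA.prod hB) (measure_ne_top _ _) (1 : ℂ) ∈ M) : M = ⊤ := by
  have : CompleteSpace M := hM.completeSpace_coe
  rw [← Submodule.orthogonal_eq_bot_iff, Submodule.eq_bot_iff]
  intro f hf
  have hint : Integrable f (μ.prod ν) := (Lp.memLp f).integrable one_le_two
  refine Lp.ext ((hint.ae_eq_zero_of_forall_setIntegral_eq_zero fun E hE _ => ?_).trans
    (Lp.coeFn_zero ℂ 2 (μ.prod ν)).symm)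
  refine setIntegral_eq_zero_of_forall_prod hint (fun A B hA hB => ?_) hE
  rw [← L2.inner_indicatorConstLp_one (hA.prod hB) (measure_ne_top _ _) f]
  exact (Submodule.mem_orthogonal M f).1 hf _ (h A B hA hB)

theorem isCompactOperator_integralOperator [IsFiniteMeasure μ] [IsFiniteMeasure ν]
    (k : Lp ℂ 2 (μ.prod ν)) : IsCompactOperator (integralOperator μ ν k) := by
  let M : Submodule ℂ (Lp ℂ 2 (μ.prod ν)) :=
    (compactOperator (RingHom.id ℂ) (Lp ℂ 2 ν) (Lp ℂ 2 μ)).comap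
      (integralOperator μ ν).toLinearMap
  have hM : IsClosed (M : Set (Lp ℂ 2 (μ.prod ν))) :=
    isClosed_setOfPred_isCompactOperator.preimage (integralOperator μ ν).continuous
  have htop : M = ⊤ := eq_top_of_forall_indicator_prod_mem hM fun A B hA hB =>
    isCompactOperator_integralOperator_indicator_prod hA hB
  exact (htop ▸ Submodule.mem_top : k ∈ M)

end HilbertSchmidtKernel

/-- For a measurable kernel `k : S × S → ℂ` with
`∫∫ |k(t,s)|² dν dν < ∞` over a finite measure space, the integral operator
`T_k : L²(S,ν) → L²(S,ν)`, `(T_k g)(t) = ∫ k(t,s) g(s) dν(s)`, is a compact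
operator. -/
theorem stmt4 {S : Type*} [MeasurableSpace S] (ν : Measure S) [IsFiniteMeasure ν]
    (k : S × S → ℂ) (hk : Measurable k)
    (hkL2 : ∫⁻ t, ∫⁻ s, ((‖k (t, s)‖₊ : ℝ≥0∞) ^ 2) ∂ν ∂ν < ⊤) :
    ∃ T : Lp ℂ 2 ν →L[ℂ] Lp ℂ 2 ν,
      (∀ g : Lp ℂ 2 ν, ∀ᵐ t ∂ν, (T g) t = ∫ s, k (t, s) * g s ∂ν) ∧
      IsCompactOperator T := by
  have hk2 : MemLp k 2 (ν.prod ν) := by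
    refine (HilbertSchmidtKernel.memLp_two_iff_lintegral hk.aestronglyMeasurable).2 ?_
    rw [lintegral_prod _ (hk.enorm.pow_const 2).aemeasurable]
    exact hkL2
  exact ⟨HilbertSchmidtKernel.integralOperator ν ν (hk2.toLp k),
    HilbertSchmidtKernel.integralOperator_toLp_apply_ae hk2,
    HilbertSchmidtKernel.isCompactOperator_integralOperator _⟩
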